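/- arXiv:1401.1368 — 7 statements merged into one kernel-verified Lean document; each statement's English description precedes it below -/
import Mathlib

section
/- For every ε > 0, the function f(x) = (log(x + e^ε))^{1+ε} on [0,∞) is increasing and subadditive, i.e. f(x+y) ≤ f(x) + f(y) for all x, y ≥ 0. -/
open Real

/-- The function `u ↦ (log u) ^ ε / u` is antitone on `[e^ε, ∞)`. -/
theorem antitoneOn_log_rpow_div_self {ε : ℝ} (hε : 0 < ε) :
    AntitoneOn (fun u : ℝ => Real.log u ^ ε / u) (Set.Ici (Real.exp ε)) := by
  intro u hu v hv huv
  have hu0 : 0 < u := (Real.exp_pos ε).trans_le hu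
  have hv0 : 0 < v := (Real.exp_pos ε).trans_le hv
  have hlu : ε ≤ Real.log u := (Real.le_log_iff_exp_le hu0).2 hu
  have hlv : ε ≤ Real.log v := (Real.le_log_iff_exp_le hv0).2 hv
  have hluv : Real.log u ≤ Real.log v := Real.log_le_log hu0 huv
  have hlu0 : 0 < Real.log u := hε.trans_le hlu
  have hlv0 : 0 < Real.log v := hε.trans_le hlv
  have hpu := Real.rpow_pos_of_pos hlu0 ε
  have hpv := Real.rpow_pos_of_pos hlv0 ε
  refine (Real.log_le_log_iff (div_pos hpv hv0) (div_pos hpu hu0)).1 ?_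
  rw [Real.log_div hpv.ne' hv0.ne', Real.log_div hpu.ne' hu0.ne', Real.log_rpow hlv0,
    Real.log_rpow hlu0]
  have hratio := Real.log_le_sub_one_of_pos (div_pos hlv0 hlu0)
  rw [Real.log_div hlv0.ne' hlu0.ne', div_sub_one hlu0.ne', le_div_iff₀ hlu0] at hratio
  have hloglog := Real.log_le_log hlu0 hluv
  nlinarith [mul_nonneg (sub_nonneg.2 hloglog) (sub_nonneg.2 hlu)]

theorem hasDerivAt_log_add_rpow {p a x : ℝ} (hx : 1 < x + a) :
    HasDerivAt (fun t : ℝ => Real.log (t + a) ^ p)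
      (p * (Real.log (x + a) ^ (p - 1) / (x + a))) x := by
  convert (((hasDerivAt_id' x).add_const a).log (by linarith)).rpow_const
    (p := p) (Or.inl (Real.log_pos hx).ne') using 1
  ring

/-- For every `ε > 0`, the function `f x = (log (x + e^ε))^{1+ε}` on `[0,∞)`
is increasing and subadditive. -/
theorem log_rpow_increasing_subadditive (ε : ℝ) (hε : 0 < ε) :
    (∀ x y : ℝ, 0 ≤ x → x ≤ y →
        Real.log (x + Real.exp ε) ^ (1 + ε) ≤ Real.log (y + Real.exp ε) ^ (1 + ε)) ∧
    (∀ x y : ℝ, 0 ≤ x → 0 ≤ y →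
        Real.log (x + y + Real.exp ε) ^ (1 + ε)
          ≤ Real.log (x + Real.exp ε) ^ (1 + ε) + Real.log (y + Real.exp ε) ^ (1 + ε)) := by
  have hexp : 1 < Real.exp ε := Real.one_lt_exp_iff.2 hε
  constructor
  · intro x y hx hxy
    exact Real.rpow_le_rpow (Real.log_nonneg (by linarith))
      (Real.log_le_log (by linarith) (by linarith)) (by linarith)
  · intro x y hx hy
    have hderiv : ∀ t ∈ Set.Ici (0 : ℝ), HasDerivAt
        (fun t : ℝ => Real.log (t + Real.exp ε) ^ (1 + ε)
          - Real.log (t + (y + Real.exp ε)) ^ (1 + ε))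
        ((1 + ε) * (Real.log (t + Real.exp ε) ^ (1 + ε - 1) / (t + Real.exp ε))
          - (1 + ε) * (Real.log (t + (y + Real.exp ε)) ^ (1 + ε - 1)
            / (t + (y + Real.exp ε)))) t := by
      intro t ht
      have ht : 0 ≤ t := ht
      exact (hasDerivAt_log_add_rpow (by linarith)).sub (hasDerivAt_log_add_rpow (by linarith))
    have hmono := monotoneOn_of_deriv_nonneg (convex_Ici (0 : ℝ))
      (fun t ht => (hderiv t ht).continuousAt.continuousWithinAt)
      (fun t ht => (hderiv t (interior_subset ht)).differentiableAt.differentiableWithinAt)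
      (fun t ht => by
        have ht' : 0 ≤ t := interior_subset ht
        rw [(hderiv t ht').deriv, add_sub_cancel_left, ← mul_sub]
        refine mul_nonneg (by linarith) (sub_nonneg.2 ?_)
        exact antitoneOn_log_rpow_div_self hε (Set.mem_Ici.2 (by linarith))
          (Set.mem_Ici.2 (by linarith)) (by linarith))
    have hle := hmono Set.self_mem_Ici (Set.mem_Ici.2 hx) hx
    have hnonneg : 0 ≤ Real.log (Real.exp ε) ^ (1 + ε) :=
      Real.rpow_nonneg (Real.log_nonneg hexp.le) _
    simp only [zero_add, ← add_assoc] at hle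
    linarith
end

section
/- Let X be a nonnegative real random variable and δ > 0. If E[X (log⁺ X)^{1+δ}] < ∞, then (log t)^δ · E[X (log X − log t) · 1_{X > t}] → 0 as t → ∞. -/
open MeasureTheory ProbabilityTheory Filter
open scoped ENNReal NNReal

theorem tendsto_measure_setOf_lt_atTop {Ω : Type*} [MeasurableSpace Ω] (μ : Measure Ω)
    [IsFiniteMeasure μ] {X : Ω → ℝ} (hX : Measurable X) :
    Tendsto (fun t : ℝ => μ {ω | t < X ω}) atTop (nhds 0) := by
  have h := tendsto_measure_iInter_atTop (μ := μ) (s := fun t : ℝ => {ω | t < X ω})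
    (fun t => (measurableSet_lt measurable_const hX).nullMeasurableSet)
    (fun s t hst ω (hω : t < X ω) => hst.trans_lt hω) ⟨0, measure_ne_top _ _⟩
  have hempty : (⋂ t : ℝ, {ω | t < X ω}) = ∅ := by
    ext ω
    simpa using ⟨X ω, le_rfl⟩
  simpa [hempty, Function.comp_def] using h

theorem rpow_log_mul_mul_log_sub_log_le {t x δ : ℝ} (hδ : 0 ≤ δ) (ht : 1 < t) (hx : t < x) :
    Real.log t ^ δ * (x * (Real.log x - Real.log t)) ≤ x * max (Real.log x) 0 ^ (1 + δ) := by
  have hx0 : 0 < x := by linarith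
  have hlt : 0 < Real.log t := Real.log_pos ht
  have hle : Real.log t < Real.log x := Real.log_lt_log (by linarith) hx
  have hlx : 0 < Real.log x := hlt.trans hle
  rw [max_eq_left hlx.le, Real.rpow_add hlx, Real.rpow_one]
  calc Real.log t ^ δ * (x * (Real.log x - Real.log t))
      ≤ Real.log x ^ δ * (x * Real.log x) := by
        gcongr
        linarith
    _ = x * (Real.log x * Real.log x ^ δ) := by ring

/-- Let `X ≥ 0` be a random variable and `δ > 0`. If
`E[X (log⁺ X)^{1+δ}] < ∞`, then `(log t)^δ · E[X (log X - log t) 1_{X > t}] → 0` as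
`t → ∞`. -/
theorem tendsto_log_pow_truncated_moment_of_integrable
    {Ω : Type*} [MeasureSpace Ω] [IsProbabilityMeasure (ℙ : Measure Ω)]
    (X : Ω → ℝ) (hXmeas : Measurable X) (hXnn : ∀ ω, 0 ≤ X ω)
    (δ : ℝ) (hδ : 0 < δ)
    (hmom : ∫⁻ ω, ENNReal.ofReal (X ω * max (Real.log (X ω)) 0 ^ (1 + δ)) ∂ℙ < ⊤) :
    Tendsto (fun t : ℝ =>
        ENNReal.ofReal (Real.log t ^ δ) *
          ∫⁻ ω in {ω | t < X ω}, ENNReal.ofReal (X ω * (Real.log (X ω) - Real.log t)) ∂ℙ)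
      atTop (nhds 0) := by
  refine tendsto_of_tendsto_of_tendsto_of_le_of_le' tendsto_const_nhds
    (tendsto_setLIntegral_zero hmom.ne (tendsto_measure_setOf_lt_atTop ℙ hXmeas))
    (Eventually.of_forall fun _ => zero_le) ?_
  filter_upwards [eventually_gt_atTop 1] with t ht
  rw [← lintegral_const_mul' _ _ ENNReal.ofReal_ne_top]
  refine setLIntegral_mono' (measurableSet_lt measurable_const hXmeas) fun ω hω => ?_
  rw [← ENNReal.ofReal_mul (Real.rpow_nonneg (Real.log_pos ht).le δ)]
  exact ENNReal.ofReal_le_ofReal (rpow_log_mul_mul_log_sub_log_le hδ.le ht hω)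
end

section
/- Let X be an integrable nonnegative real random variable and δ > 0. If (log t)^δ · E[X (log X − log t) · 1_{X > t}] → 0 as t → ∞, then E[X (log⁺ X)^{1+δ−ε}] < ∞ for every ε ∈ (0, 1+δ). -/
open MeasureTheory ProbabilityTheory Filter
open scoped ENNReal NNReal

/-- On a scale `a` with `2a ≤ y ≤ 4a`, the power `y ^ p` is controlled by the excess `y - a`. -/
lemma rpow_le_mul_sub_of_mem_Icc {a y p : ℝ} (ha : 0 < a) (hp : 0 ≤ p) (h₂ : 2 * a ≤ y)
    (h₄ : y ≤ 4 * a) : y ^ p ≤ (4 * a) ^ p / a * (y - a) := by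
  have h : y ^ p ≤ (4 * a) ^ p := Real.rpow_le_rpow (by linarith) h₄ hp
  calc y ^ p ≤ (4 * a) ^ p / a * a := by rwa [div_mul_cancel₀ _ ha.ne']
    _ ≤ (4 * a) ^ p / a * (y - a) := by gcongr; linarith

/-- A dyadic domination of `x (log⁺ x) ^ p` by the excesses `x (log x - 2 ^ k)` over the levels
`exp (2 ^ k)`, `k ≥ K`. -/
lemma ofReal_mul_posLog_rpow_le_tsum {x p : ℝ} (hx : 0 ≤ x) (hp : 0 < p) (K : ℕ) :
    ENNReal.ofReal (x * max (Real.log x) 0 ^ p) ≤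
      ENNReal.ofReal (((2 : ℝ) ^ (K + 1)) ^ p * x) +
        ∑' j : ℕ, ENNReal.ofReal ((4 * (2 : ℝ) ^ (K + j)) ^ p / 2 ^ (K + j)) *
          {y : ℝ | Real.exp (2 ^ (K + j)) < y}.indicator
            (fun y => ENNReal.ofReal (y * (Real.log y - Real.log (Real.exp (2 ^ (K + j)))))) x := by
  rcases le_total (Real.log x) (2 ^ (K + 1)) with h | h
  · refine le_add_right (ENNReal.ofReal_le_ofReal ?_)
    rw [mul_comm]
    gcongr
    exact max_le h (by positivity)
  · have h1 : (1 : ℝ) ≤ 2 ^ (K + 1) := one_le_pow₀ one_le_two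
    have hx0 : 0 < x := hx.lt_of_ne' fun h0 => by simp [h0] at h; linarith
    obtain ⟨n, hn, hn'⟩ := exists_nat_pow_near (h1.trans h) one_lt_two
    have hKn : K + 1 ≤ n := by
      have := (pow_lt_pow_iff_right₀ (one_lt_two (α := ℝ))).1 (h.trans_lt hn')
      lia
    obtain ⟨j, rfl⟩ := Nat.exists_eq_add_of_le hKn
    have ha : (0 : ℝ) < 2 ^ (K + j) := by positivity
    have h₂ : 2 * (2 : ℝ) ^ (K + j) ≤ Real.log x :=
      le_of_eq_of_le (by ring) hn
    have h₄ : Real.log x ≤ 4 * (2 : ℝ) ^ (K + j) :=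
      hn'.le.trans_eq (by ring)
    refine le_add_left (le_trans ?_ (ENNReal.le_tsum j))
    have hmem : x ∈ {y : ℝ | Real.exp (2 ^ (K + j)) < y} :=
      (Real.lt_log_iff_exp_lt hx0).1 (by linarith)
    rw [Set.indicator_of_mem hmem, ← ENNReal.ofReal_mul (by positivity), Real.log_exp,
      max_eq_left (by linarith)]
    apply ENNReal.ofReal_le_ofReal
    calc x * Real.log x ^ p
        ≤ x * ((4 * (2 : ℝ) ^ (K + j)) ^ p / 2 ^ (K + j) * (Real.log x - 2 ^ (K + j))) := by
          gcongr
          exact rpow_le_mul_sub_of_mem_Icc ha hp.le h₂ h₄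
      _ = _ := by ring

/-- The weights `(4 a) ^ p / a` with `a = 2 ^ (K + j)` and `p = 1 + δ - ε` factor as a geometric
sequence times `a ^ δ`. -/
lemma four_mul_rpow_div_eq (K j : ℕ) (δ ε : ℝ) :
    (4 * (2 : ℝ) ^ (K + j)) ^ (1 + δ - ε) / 2 ^ (K + j) =
      (4 : ℝ) ^ (1 + δ - ε) * ((2 : ℝ) ^ (-ε)) ^ (K + j) * ((2 : ℝ) ^ (K + j)) ^ δ := by
  have ha : (0 : ℝ) < 2 ^ (K + j) := by positivity
  have hε : ((2 : ℝ) ^ (-ε)) ^ (K + j) = ((2 : ℝ) ^ (K + j)) ^ (-ε) :=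
    Real.rpow_pow_comm zero_le_two _ _
  rw [Real.mul_rpow (by norm_num) ha.le, hε, mul_assoc, ← Real.rpow_add ha, mul_div_assoc]
  congr 1
  rw [div_eq_iff ha.ne', ← Real.rpow_add_one ha.ne']
  ring_nf

/-- Let `X ≥ 0` be integrable and `δ > 0`. If
`(log t)^δ · E[X (log X - log t) 1_{X > t}] → 0` as `t → ∞`, then
`E[X (log⁺ X)^{1+δ-ε}] < ∞` for every `ε ∈ (0, 1+δ)`. -/
theorem moment_lt_top_of_tendsto_log_pow_truncated_moment
    {Ω : Type*} [MeasureSpace Ω] [IsProbabilityMeasure (ℙ : Measure Ω)]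
    (X : Ω → ℝ) (hXmeas : Measurable X) (hXnn : ∀ ω, 0 ≤ X ω)
    (hXint : Integrable X ℙ)
    (δ : ℝ) (hδ : 0 < δ)
    (hlim : Tendsto (fun t : ℝ =>
        ENNReal.ofReal (Real.log t ^ δ) *
          ∫⁻ ω in {ω | t < X ω}, ENNReal.ofReal (X ω * (Real.log (X ω) - Real.log t)) ∂ℙ)
      atTop (nhds 0)) :
    ∀ ε : ℝ, 0 < ε → ε < 1 + δ →
      ∫⁻ ω, ENNReal.ofReal (X ω * max (Real.log (X ω)) 0 ^ (1 + δ - ε)) ∂ℙ < ⊤ := by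
  intro ε hε hεδ
  have hlevels : Tendsto (fun k : ℕ => Real.exp ((2 : ℝ) ^ k)) atTop atTop :=
    Real.tendsto_exp_atTop.comp (tendsto_pow_atTop_atTop_of_one_lt one_lt_two)
  obtain ⟨K, hK⟩ := eventually_atTop.1 ((hlim.comp hlevels).eventually_le_const zero_lt_one)
  set r : ℝ := (2 : ℝ) ^ (-ε)
  have hr0 : 0 ≤ r := by positivity
  have hr1 : r < 1 := Real.rpow_lt_one_of_one_lt_of_neg one_lt_two (by linarith)
  set C : ℝ := (4 : ℝ) ^ (1 + δ - ε)
  have hsum : Summable fun j : ℕ => C * r ^ (K + j) := by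
    simp_rw [pow_add]
    exact ((summable_geometric_of_lt_one hr0 hr1).mul_left _).mul_left _
  let e : ℕ → ℝ → ℝ≥0∞ := fun j => {y : ℝ | Real.exp (2 ^ (K + j)) < y}.indicator
    fun y => ENNReal.ofReal (y * (Real.log y - Real.log (Real.exp (2 ^ (K + j)))))
  have he (j : ℕ) : Measurable fun ω => e j (X ω) :=
    Measurable.comp (Measurable.indicator (by fun_prop) measurableSet_Ioi) hXmeas
  have hterm (j : ℕ) :
      ENNReal.ofReal ((4 * (2 : ℝ) ^ (K + j)) ^ (1 + δ - ε) / 2 ^ (K + j)) *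
        ∫⁻ ω, e j (X ω) ∂ℙ ≤ ENNReal.ofReal (C * r ^ (K + j)) := by
    have hint : ∫⁻ ω, e j (X ω) ∂ℙ = ∫⁻ ω in {ω | Real.exp (2 ^ (K + j)) < X ω},
        ENNReal.ofReal (X ω * (Real.log (X ω) - Real.log (Real.exp (2 ^ (K + j))))) ∂ℙ := by
      rw [← lintegral_indicator (measurableSet_lt measurable_const hXmeas)]
      rfl
    have hle := hK (K + j) (Nat.le_add_right K j)
    simp only [Function.comp_apply] at hle
    rw [← hint, Real.log_exp] at hle
    rw [four_mul_rpow_div_eq, ENNReal.ofReal_mul (by positivity), mul_assoc]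
    exact mul_le_of_le_one_right' hle
  calc ∫⁻ ω, ENNReal.ofReal (X ω * max (Real.log (X ω)) 0 ^ (1 + δ - ε)) ∂ℙ
      ≤ ∫⁻ ω, (ENNReal.ofReal (((2 : ℝ) ^ (K + 1)) ^ (1 + δ - ε) * X ω) +
          ∑' j : ℕ, ENNReal.ofReal ((4 * (2 : ℝ) ^ (K + j)) ^ (1 + δ - ε) / 2 ^ (K + j)) *
            e j (X ω)) ∂ℙ :=
        lintegral_mono fun ω => ofReal_mul_posLog_rpow_le_tsum (hXnn ω) (by linarith) K
    _ = ∫⁻ ω, ENNReal.ofReal (((2 : ℝ) ^ (K + 1)) ^ (1 + δ - ε) * X ω) ∂ℙ +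
          ∑' j : ℕ, ENNReal.ofReal ((4 * (2 : ℝ) ^ (K + j)) ^ (1 + δ - ε) / 2 ^ (K + j)) *
            ∫⁻ ω, e j (X ω) ∂ℙ := by
        rw [lintegral_add_left (by fun_prop),
          lintegral_tsum fun j => ((he j).const_mul _).aemeasurable]
        congr 2 with j
        exact lintegral_const_mul _ (he j)
    _ < ⊤ := ENNReal.add_lt_top.2 ⟨(hXint.const_mul _).lintegral_lt_top,
        (ENNReal.tsum_le_tsum hterm).trans_lt hsum.tsum_ofReal_lt_top⟩
end

section
/- Let X be a nonnegative real random variable and ρ > 0. Then ρ · ∫₁^∞ t^{-1} (log t)^{ρ−1} · E[X (log X − log t) 1_{X > t}] dt = (1+ρ)^{-1} · E[X (log⁺ X)^{1+ρ}], as an identity in [0,∞]. -/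
open MeasureTheory ProbabilityTheory Filter
open scoped ENNReal NNReal

theorem lintegral_Ioo_ofReal_deriv_eq_sub {g g' : ℝ → ℝ} {a b : ℝ} (hab : a ≤ b)
    (hcont : ContinuousOn g (Set.Icc a b))
    (hderiv : ∀ x ∈ Set.Ioo a b, HasDerivAt g (g' x) x)
    (hpos : ∀ x ∈ Set.Ioo a b, 0 ≤ g' x) :
    ∫⁻ x in Set.Ioo a b, ENNReal.ofReal (g' x) = ENNReal.ofReal (g b - g a) := by
  have hint : IntegrableOn g' (Set.Ioc a b) :=
    intervalIntegral.integrableOn_deriv_of_nonneg hcont hderiv hpos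
  have hint' : IntervalIntegrable g' volume a b :=
    (intervalIntegrable_iff_integrableOn_Ioc_of_le hab).2 hint
  rw [← intervalIntegral.integral_eq_sub_of_hasDerivAt_of_le hab hcont hderiv hint',
    intervalIntegral.integral_of_le hab, integral_Ioc_eq_integral_Ioo,
    ofReal_integral_eq_lintegral_ofReal (hint.mono_set Set.Ioo_subset_Ioc_self)]
  exact (ae_restrict_iff' measurableSet_Ioo).2 (ae_of_all _ hpos)

theorem lintegral_Ioo_inv_mul_log_rpow_mul_log_sub_log {ρ x : ℝ} (hρ : 0 < ρ) (hx : 1 ≤ x) :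
    ∫⁻ t in Set.Ioo 1 x,
        ENNReal.ofReal (t⁻¹ * Real.log t ^ (ρ - 1) * (Real.log x - Real.log t)) =
      ENNReal.ofReal (ρ⁻¹ * (1 + ρ)⁻¹ * Real.log x ^ (1 + ρ)) := by
  have hlog : ContinuousOn Real.log (Set.Icc 1 x) :=
    Real.continuousOn_log.mono fun t ht => (zero_lt_one.trans_le ht.1).ne'
  have hρ' : 0 < 1 + ρ := by positivity
  rw [lintegral_Ioo_ofReal_deriv_eq_sub
    (g := fun t => Real.log x * (ρ⁻¹ * Real.log t ^ ρ) - (1 + ρ)⁻¹ * Real.log t ^ (1 + ρ)) hx]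
  · congr 1
    have hL : Real.log x ^ (1 + ρ) = Real.log x * Real.log x ^ ρ := by
      rw [Real.rpow_add_of_nonneg (Real.log_nonneg hx) zero_le_one hρ.le, Real.rpow_one]
    simp only [Real.log_one, Real.zero_rpow hρ.ne', Real.zero_rpow hρ'.ne', hL]
    field_simp
    ring
  · exact (continuousOn_const.mul (continuousOn_const.mul
      (hlog.rpow_const fun _ _ => Or.inr hρ.le))).sub
      (continuousOn_const.mul (hlog.rpow_const fun _ _ => Or.inr hρ'.le))
  · intro t ht
    have ht0 : 0 < t := zero_lt_one.trans ht.1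
    have hl : 0 < Real.log t := Real.log_pos ht.1
    have hd := Real.hasDerivAt_log ht0.ne'
    have h := (((hd.rpow_const (p := ρ) (Or.inl hl.ne')).const_mul ρ⁻¹).const_mul
      (Real.log x)).sub ((hd.rpow_const (p := 1 + ρ) (Or.inl hl.ne')).const_mul (1 + ρ)⁻¹)
    refine h.congr_deriv ?_
    rw [show 1 + ρ - 1 = (ρ - 1) + 1 by ring, Real.rpow_add_one hl.ne']
    field_simp
  · intro t ht
    have ht0 : 0 < t := zero_lt_one.trans ht.1
    have := Real.log_pos ht.1
    have := sub_nonneg.2 (Real.log_le_log ht0 ht.2.le)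
    positivity

theorem lintegral_Ioi_indicator_mul_log_sub_log {ρ x : ℝ} (hρ : 0 < ρ) (hx : 0 ≤ x) :
    ∫⁻ t in Set.Ioi (1 : ℝ), ENNReal.ofReal (t⁻¹ * Real.log t ^ (ρ - 1)) *
        (Set.Iio x).indicator (fun t => ENNReal.ofReal (x * (Real.log x - Real.log t))) t =
      ENNReal.ofReal (ρ⁻¹ * (1 + ρ)⁻¹) *
        ENNReal.ofReal (x * max (Real.log x) 0 ^ (1 + ρ)) := by
  have hind : ∀ t : ℝ, ENNReal.ofReal (t⁻¹ * Real.log t ^ (ρ - 1)) *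
      (Set.Iio x).indicator (fun t => ENNReal.ofReal (x * (Real.log x - Real.log t))) t =
      (Set.Iio x).indicator (fun t => ENNReal.ofReal (t⁻¹ * Real.log t ^ (ρ - 1)) *
        ENNReal.ofReal (x * (Real.log x - Real.log t))) t :=
    fun t => (Set.indicator_mul_right _
      (fun t => ENNReal.ofReal (t⁻¹ * Real.log t ^ (ρ - 1))) _).symm
  simp only [hind]
  rw [setLIntegral_indicator measurableSet_Iio, Set.Iio_inter_Ioi]
  rcases le_total x 1 with h | h
  · rw [Set.Ioo_eq_empty (not_lt.2 h), max_eq_right (Real.log_nonpos hx h),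
      Real.zero_rpow (by positivity)]
    simp
  · rw [max_eq_left (Real.log_nonneg h), mul_comm x, ENNReal.ofReal_mul' hx, ← mul_assoc,
      ← ENNReal.ofReal_mul (by positivity),
      ← lintegral_Ioo_inv_mul_log_rpow_mul_log_sub_log hρ h,
      ← lintegral_mul_const' _ _ ENNReal.ofReal_ne_top]
    refine setLIntegral_congr_fun measurableSet_Ioo fun t ht => ?_
    have ht0 : 0 < t := zero_lt_one.trans ht.1
    have := Real.log_pos ht.1
    rw [← ENNReal.ofReal_mul (by positivity), ← ENNReal.ofReal_mul' hx]
    congr 1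
    ring

/-- For a nonnegative random variable `X` and `ρ > 0`,
`ρ · ∫₁^∞ t⁻¹ (log t)^{ρ-1} E[X (log X - log t) 1_{X > t}] dt
  = (1+ρ)⁻¹ · E[X (log⁺ X)^{1+ρ}]`, as an identity in `[0,∞]`. -/
theorem integral_log_pow_truncated_moment_eq
    {Ω : Type*} [MeasureSpace Ω] [IsProbabilityMeasure (ℙ : Measure Ω)]
    (X : Ω → ℝ) (hXmeas : Measurable X) (hXnn : ∀ ω, 0 ≤ X ω)
    (ρ : ℝ) (hρ : 0 < ρ) :
    ENNReal.ofReal ρ *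
        ∫⁻ t in Set.Ioi (1 : ℝ),
          ENNReal.ofReal (t⁻¹ * Real.log t ^ (ρ - 1)) *
            ∫⁻ ω in {ω | t < X ω}, ENNReal.ofReal (X ω * (Real.log (X ω) - Real.log t)) ∂ℙ
      = (ENNReal.ofReal (1 + ρ))⁻¹ *
          ∫⁻ ω, ENNReal.ofReal (X ω * max (Real.log (X ω)) 0 ^ (1 + ρ)) ∂ℙ := by
  have hinner : ∀ t : ℝ, ENNReal.ofReal (t⁻¹ * Real.log t ^ (ρ - 1)) *
      ∫⁻ ω in {ω | t < X ω}, ENNReal.ofReal (X ω * (Real.log (X ω) - Real.log t)) ∂ℙ =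
      ∫⁻ ω, ENNReal.ofReal (t⁻¹ * Real.log t ^ (ρ - 1)) * (Set.Iio (X ω)).indicator
        (fun s => ENNReal.ofReal (X ω * (Real.log (X ω) - Real.log s))) t ∂ℙ := by
    intro t
    rw [← lintegral_indicator (measurableSet_lt measurable_const hXmeas),
      ← lintegral_const_mul' _ _ ENNReal.ofReal_ne_top]
    rfl
  have hmeas : Measurable (Function.uncurry fun (t : ℝ) (ω : Ω) =>
      ENNReal.ofReal (t⁻¹ * Real.log t ^ (ρ - 1)) * (Set.Iio (X ω)).indicator
        (fun s => ENNReal.ofReal (X ω * (Real.log (X ω) - Real.log s))) t) := by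
    have hset : MeasurableSet {p : ℝ × Ω | p.1 < X p.2} :=
      measurableSet_lt measurable_fst (hXmeas.comp measurable_snd)
    have hfun : Measurable fun p : ℝ × Ω =>
        ENNReal.ofReal (X p.2 * (Real.log (X p.2) - Real.log p.1)) := by fun_prop
    have hweight : Measurable fun p : ℝ × Ω =>
        ENNReal.ofReal (p.1⁻¹ * Real.log p.1 ^ (ρ - 1)) := by fun_prop
    exact hweight.mul (hfun.indicator hset)
  simp only [hinner]
  rw [lintegral_lintegral_swap hmeas.aemeasurable]
  simp only [lintegral_Ioi_indicator_mul_log_sub_log hρ (hXnn _)]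
  rw [lintegral_const_mul' _ _ ENNReal.ofReal_ne_top, ← mul_assoc, ← ENNReal.ofReal_mul hρ.le,
    mul_inv_cancel_left₀ hρ.ne', ENNReal.ofReal_inv_of_pos (by positivity)]
end

section
/- Let X be a nonnegative real random variable and θ > 0. Then Σ_{n≥2} P(X > n (log n)^{-θ}) < ∞ if and only if E[X (log⁺ X)^θ] < ∞. -/
open MeasureTheory ProbabilityTheory Filter
open scoped ENNReal NNReal

lemma tsum_indicator_le_ofReal (s : Set ℕ) (B : ℝ) (h : ∀ n ∈ s, (n : ℝ) + 1 ≤ B) :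
    ∑' n, s.indicator (fun _ => (1 : ℝ≥0∞)) n ≤ ENNReal.ofReal B := by
  rcases le_or_gt 0 B with hB | hB
  · have hz : ∀ n ∉ Finset.range ⌊B⌋₊, s.indicator (fun _ => (1 : ℝ≥0∞)) n = 0 := by
      intro n hn
      refine Set.indicator_of_notMem (fun hs => hn ?_) _
      rw [Finset.mem_range, ← Nat.succ_le_iff]
      apply Nat.le_floor
      simpa using h n hs
    rw [tsum_eq_sum hz]
    calc ∑ n ∈ Finset.range ⌊B⌋₊, s.indicator (fun _ => (1 : ℝ≥0∞)) n
        ≤ ∑ n ∈ Finset.range ⌊B⌋₊, 1 :=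
          Finset.sum_le_sum fun n _ => Set.indicator_le_self' (by simp) n
      _ = ENNReal.ofReal (⌊B⌋₊ : ℝ) := by simp
      _ ≤ ENNReal.ofReal B := ENNReal.ofReal_le_ofReal (Nat.floor_le hB)
  · have : s = ∅ := by
      ext n
      simp only [Set.mem_empty_iff_false, iff_false]
      intro hn
      have := h n hn
      have : (0 : ℝ) ≤ n := n.cast_nonneg
      linarith
    simp [this]

lemma ofReal_le_tsum_indicator (s : Set ℕ) (p y : ℝ) (hp : 0 ≤ p)
    (h : ∀ n : ℕ, p < (n : ℝ) + 2 → (n : ℝ) + 2 < y → n ∈ s) :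
    ENNReal.ofReal (y - p - 2) ≤ ∑' n, s.indicator (fun _ => (1 : ℝ≥0∞)) n := by
  have hmem : ∀ n ∈ Finset.Ico ⌊p⌋₊ (⌈y⌉₊ - 2), n ∈ s := by
    intro n hn
    rw [Finset.mem_Ico] at hn
    apply h
    · have h₁ := Nat.lt_floor_add_one p
      have h₂ : (⌊p⌋₊ : ℝ) ≤ n := by exact_mod_cast hn.1
      linarith
    · have h₁ : n + 2 < ⌈y⌉₊ := by omega
      simpa using Nat.lt_ceil.1 h₁
  calc ENNReal.ofReal (y - p - 2)
      ≤ ENNReal.ofReal ((⌈y⌉₊ - 2 - ⌊p⌋₊ : ℕ) : ℝ) := by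
        apply ENNReal.ofReal_le_ofReal
        have h₁ := Nat.floor_le hp
        have h₂ := Nat.le_ceil y
        have h₃ : (⌈y⌉₊ : ℝ) ≤ ((⌈y⌉₊ - 2 - ⌊p⌋₊ : ℕ) : ℝ) + 2 + ⌊p⌋₊ := by
          norm_cast
          omega
        linarith
    _ = ∑ n ∈ Finset.Ico ⌊p⌋₊ (⌈y⌉₊ - 2), 1 := by simp
    _ = ∑ n ∈ Finset.Ico ⌊p⌋₊ (⌈y⌉₊ - 2), s.indicator (fun _ => (1 : ℝ≥0∞)) n :=
        Finset.sum_congr rfl fun n hn => by simp [hmem n hn]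
    _ ≤ _ := ENNReal.sum_le_tsum _

lemma mul_log_rpow_neg_lt_iff {t x θ : ℝ} (ht : 1 < t) :
    t * Real.log t ^ (-θ) < x ↔ t < x * Real.log t ^ θ := by
  have hl := Real.log_pos ht
  rw [Real.rpow_neg hl.le, ← div_eq_mul_inv, div_lt_iff₀ (Real.rpow_pos_of_pos hl θ)]

lemma exists_le_add_of_lt_mul_log_rpow (θ : ℝ) (hθ : 0 < θ) :
    ∃ T : ℝ, 0 ≤ T ∧ ∀ x t : ℝ, 0 ≤ x → 1 < t → t < x * Real.log t ^ θ →
      t ≤ T + 2 ^ θ * (x * max (Real.log x) 0 ^ θ) := by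
  have ho := (isLittleO_log_rpow_rpow_atTop θ (show (0 : ℝ) < 1 / 2 by norm_num)).bound one_pos
  obtain ⟨T, hT⟩ := eventually_atTop.1 ho
  refine ⟨max T 0, le_max_right _ _, fun x t hx ht h => ?_⟩
  have hg : 0 ≤ 2 ^ θ * (x * max (Real.log x) 0 ^ θ) := by positivity
  rcases le_total t T with htT | htT
  · linarith [le_max_left T 0]
  have hlt := Real.log_pos ht
  have hb := hT t htT
  rw [one_mul, Real.norm_of_nonneg (by positivity), Real.norm_of_nonneg (by positivity),
    ← Real.sqrt_eq_rpow] at hb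
  have hs : 0 < √t := Real.sqrt_pos.2 (by linarith)
  have hsq : √t * √t = t := Real.mul_self_sqrt (by linarith)
  have hsx : √t < x := by
    have : √t * √t < x * √t := by
      rw [hsq]; exact h.trans_le (by gcongr)
    exact lt_of_mul_lt_mul_right this hs.le
  have hlog : Real.log t ≤ 2 * Real.log x := by
    have := Real.log_le_log hs hsx.le
    rw [Real.log_sqrt (by linarith)] at this
    linarith
  have hlx : 0 ≤ Real.log x := by linarith
  have : x * Real.log t ^ θ ≤ x * (2 * Real.log x) ^ θ := by gcongr
  rw [Real.mul_rpow (by norm_num) hlx] at this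
  rw [max_eq_left hlx]
  nlinarith [le_max_right T 0]

lemma exists_lt_mul_log_rpow_of_sqrt_lt (θ : ℝ) (hθ : 0 < θ) :
    ∃ M : ℝ, 4 ≤ M ∧ ∀ x : ℝ, M ≤ x →
      x * Real.log x ^ θ ≤ 2 * 2 ^ θ * (x * (Real.log x / 2) ^ θ - √x - 2) ∧
      ∀ t : ℝ, √x < t → t < x * (Real.log x / 2) ^ θ → t < x * Real.log t ^ θ := by
  have ho : Tendsto (fun x : ℝ => (Real.log x / 2) ^ θ) atTop atTop :=
    (tendsto_rpow_atTop hθ).comp (Real.tendsto_log_atTop.atTop_div_const two_pos)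
  obtain ⟨M, hM⟩ := eventually_atTop.1 (ho.eventually_ge_atTop 2)
  refine ⟨max M 4, le_max_right _ _, fun x hx => ?_⟩
  have hx4 : 4 ≤ x := (le_max_right _ _).trans hx
  have h2 := hM x ((le_max_left _ _).trans hx)
  have hlx : 0 < Real.log x := Real.log_pos (by linarith)
  constructor
  · have hs : √x ≤ x / 2 := Real.sqrt_le_iff.2 ⟨by linarith, by nlinarith⟩
    have he : x * Real.log x ^ θ = 2 ^ θ * (x * (Real.log x / 2) ^ θ) := by
      rw [Real.div_rpow hlx.le (by norm_num)]
      field_simp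
    have hy : x * 2 ≤ x * (Real.log x / 2) ^ θ := by gcongr
    rw [he, mul_comm 2, mul_assoc]
    exact mul_le_mul_of_nonneg_left (by linarith) (by positivity)
  · intro t hst ht
    have hlog : Real.log x / 2 ≤ Real.log t := by
      rw [← Real.log_sqrt (by linarith)]
      exact Real.log_le_log (Real.sqrt_pos.2 (by linarith)) hst.le
    exact ht.trans_le (by gcongr)

/-- For a nonnegative random variable `X` and `θ > 0`,
`∑_{n ≥ 2} P(X > n (log n)^{-θ}) < ∞` if and only if `E[X (log⁺ X)^θ] < ∞`. -/
theorem tsum_prob_lt_top_iff_moment_lt_top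
    {Ω : Type*} [MeasureSpace Ω] [IsProbabilityMeasure (ℙ : Measure Ω)]
    (X : Ω → ℝ) (hXmeas : Measurable X) (hXnn : ∀ ω, 0 ≤ X ω)
    (θ : ℝ) (hθ : 0 < θ) :
    (∑' n : ℕ, ℙ {ω | ((n + 2 : ℕ) : ℝ) * Real.log ((n + 2 : ℕ) : ℝ) ^ (-θ) < X ω} < ⊤)
      ↔ ∫⁻ ω, ENNReal.ofReal (X ω * max (Real.log (X ω)) 0 ^ θ) ∂ℙ < ⊤ := by
  set c : ℕ → ℝ := fun n => ((n + 2 : ℕ) : ℝ) * Real.log ((n + 2 : ℕ) : ℝ) ^ (-θ)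
  have hc : ∀ (n : ℕ) (x : ℝ), c n < x ↔ (n : ℝ) + 2 < x * Real.log ((n : ℝ) + 2) ^ θ := by
    intro n x
    have h1 : (1 : ℝ) < (n : ℝ) + 2 := by linarith [n.cast_nonneg (α := ℝ)]
    simpa [c] using mul_log_rpow_neg_lt_iff (x := x) (θ := θ) h1
  have hsum : ∑' n : ℕ, ℙ {ω | c n < X ω}
      = ∫⁻ ω, ∑' n : ℕ, {n | c n < X ω}.indicator (fun _ => (1 : ℝ≥0∞)) n ∂ℙ := by
    have hm : ∀ n, MeasurableSet {ω | c n < X ω} := fun n =>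
      measurableSet_lt measurable_const hXmeas
    calc ∑' n : ℕ, ℙ {ω | c n < X ω}
        = ∑' n : ℕ, ∫⁻ ω, {ω | c n < X ω}.indicator (fun _ => (1 : ℝ≥0∞)) ω ∂ℙ := by
          simp [lintegral_indicator_const (hm _)]
      _ = ∫⁻ ω, ∑' n : ℕ, {ω | c n < X ω}.indicator (fun _ => (1 : ℝ≥0∞)) ω ∂ℙ :=
          (lintegral_tsum fun n => (measurable_const.indicator (hm n)).aemeasurable).symm
      _ = _ := rfl
  change ∑' n : ℕ, ℙ {ω | c n < X ω} < ⊤ ↔ _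
  rw [hsum]
  constructor
  · intro hfin
    obtain ⟨M, hM4, hM⟩ := exists_lt_mul_log_rpow_of_sqrt_lt θ hθ
    have hle : ∀ ω, ENNReal.ofReal (X ω * max (Real.log (X ω)) 0 ^ θ)
        ≤ ENNReal.ofReal (M * Real.log M ^ θ) + ENNReal.ofReal (2 * 2 ^ θ) *
          ∑' n : ℕ, {n | c n < X ω}.indicator (fun _ => (1 : ℝ≥0∞)) n := by
      intro ω
      have hx := hXnn ω
      generalize X ω = x at hx
      have hlM : 0 ≤ Real.log M := Real.log_nonneg (by linarith)
      rcases lt_or_ge x M with hxM | hxM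
      · refine le_add_of_le_left (ENNReal.ofReal_le_ofReal ?_)
        have hl : max (Real.log x) 0 ≤ Real.log M := by
          refine max_le ?_ hlM
          rcases hx.eq_or_lt with rfl | hx0
          · simpa using hlM
          · exact Real.log_le_log hx0 hxM.le
        gcongr
      · obtain ⟨h1, h2⟩ := hM x hxM
        rw [max_eq_left (Real.log_nonneg (by linarith))]
        refine le_add_of_le_right ((ENNReal.ofReal_le_ofReal h1).trans ?_)
        rw [ENNReal.ofReal_mul (by positivity)]
        gcongr
        exact ofReal_le_tsum_indicator _ _ _ (Real.sqrt_nonneg x)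
          fun n hn1 hn2 => (hc n x).2 (h2 _ hn1 hn2)
    refine (lintegral_mono hle).trans_lt ?_
    rw [lintegral_add_left measurable_const, lintegral_const_mul' _ _ ENNReal.ofReal_ne_top]
    exact ENNReal.add_lt_top.2 ⟨by simp, ENNReal.mul_lt_top ENNReal.ofReal_lt_top hfin⟩
  · intro hfin
    obtain ⟨T, hT0, hT⟩ := exists_le_add_of_lt_mul_log_rpow θ hθ
    have hle : ∀ ω, ∑' n : ℕ, {n | c n < X ω}.indicator (fun _ => (1 : ℝ≥0∞)) n
        ≤ ENNReal.ofReal T + ENNReal.ofReal (2 ^ θ) *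
          ENNReal.ofReal (X ω * max (Real.log (X ω)) 0 ^ θ) := by
      intro ω
      have hx := hXnn ω
      rw [← ENNReal.ofReal_mul (by positivity), ← ENNReal.ofReal_add hT0 (by positivity)]
      refine tsum_indicator_le_ofReal _ _ fun n hn => ?_
      have := hT (X ω) (n + 2) hx (by linarith [n.cast_nonneg (α := ℝ)]) ((hc n _).1 hn)
      linarith
    refine (lintegral_mono hle).trans_lt ?_
    rw [lintegral_add_left measurable_const, lintegral_const_mul' _ _ ENNReal.ofReal_ne_top]
    exact ENNReal.add_lt_top.2 ⟨by simp, ENNReal.mul_lt_top ENNReal.ofReal_lt_top hfin⟩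
end

section
/- Let Y be a real random variable and θ > 0. Then Σ_{n≥2} n^{-2} (log n)^{2θ} · E[Y² 1_{|Y| ≤ n (log n)^{-θ}}] < ∞ if and only if E[|Y| (log⁺ |Y|)^θ] < ∞. -/
open MeasureTheory ProbabilityTheory Filter
open scoped ENNReal NNReal

/-- The `n`-th weight `(n + 2)⁻² (log (n + 2))^{2θ}`. -/
noncomputable def logWeight (θ : ℝ) (n : ℕ) : ℝ :=
  ((n + 2 : ℕ) : ℝ) ^ (-(2 : ℝ)) * Real.log ((n + 2 : ℕ) : ℝ) ^ (2 * θ)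

/-- The sum of the weights of those indices whose truncation level is at least `y`. -/
noncomputable def logWeightTail (θ y : ℝ) : ℝ≥0∞ :=
  ∑' n : ℕ, if y ≤ ((n + 2 : ℕ) : ℝ) * Real.log ((n + 2 : ℕ) : ℝ) ^ (-θ) then
    ENNReal.ofReal (logWeight θ n) else 0

lemma log_natCast_add_two_pos (n : ℕ) : 0 < Real.log ((n + 2 : ℕ) : ℝ) :=
  Real.log_pos (by push_cast; linarith [(Nat.cast_nonneg n : (0 : ℝ) ≤ n)])

lemma logWeight_nonneg (θ : ℝ) (n : ℕ) : 0 ≤ logWeight θ n :=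
  mul_nonneg (by positivity) (Real.rpow_nonneg (log_natCast_add_two_pos n).le _)

lemma logWeight_eq_div (θ : ℝ) (n : ℕ) :
    logWeight θ n = Real.log ((n + 2 : ℕ) : ℝ) ^ (2 * θ) / ((n + 2 : ℕ) : ℝ) ^ 2 := by
  rw [logWeight, Real.rpow_neg (by positivity), Real.rpow_ofNat, div_eq_inv_mul]

lemma le_mul_log_rpow_neg_iff (θ y : ℝ) (n : ℕ) :
    y ≤ ((n + 2 : ℕ) : ℝ) * Real.log ((n + 2 : ℕ) : ℝ) ^ (-θ) ↔
      y * Real.log ((n + 2 : ℕ) : ℝ) ^ θ ≤ ((n + 2 : ℕ) : ℝ) := by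
  rw [Real.rpow_neg (log_natCast_add_two_pos n).le, ← div_eq_mul_inv,
    le_div_iff₀ (Real.rpow_pos_of_pos (log_natCast_add_two_pos n) _)]

lemma one_div_mul_sqrt_le {x : ℝ} (hx : 1 ≤ x) :
    1 / (x * √x) ≤ 4 * (1 / √x - 1 / √(x + 1)) := by
  have hs : 0 < √x := Real.sqrt_pos.2 (by linarith)
  have ht : 0 < √(x + 1) := Real.sqrt_pos.2 (by linarith)
  have hs2 : √x ^ 2 = x := Real.sq_sqrt (by linarith)
  have ht2 : √(x + 1) ^ 2 = x + 1 := Real.sq_sqrt (by linarith)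
  have hst : √x ≤ √(x + 1) := Real.sqrt_le_sqrt (by linarith)
  have h1 : 1 / √x - 1 / √(x + 1) = 1 / (√x * √(x + 1) * (√x + √(x + 1))) := by
    field_simp
    nlinarith
  rw [h1, ← mul_div_assoc, div_le_div_iff₀ (by positivity) (by positivity)]
  have h2 : √(x + 1) * (√x + √(x + 1)) ≤ 4 * x := by nlinarith
  calc 1 * (√x * √(x + 1) * (√x + √(x + 1))) = √x * (√(x + 1) * (√x + √(x + 1))) := by ring
    _ ≤ √x * (4 * x) := by gcongr
    _ = 4 * 1 * (x * √x) := by ring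

lemma tsum_one_div_mul_sqrt_tail_le {T : ℝ} (hT : 0 < T) :
    ∑' n : ℕ, ENNReal.ofReal (if T ≤ ((n + 2 : ℕ) : ℝ) then
      1 / (((n + 2 : ℕ) : ℝ) * √((n + 2 : ℕ) : ℝ)) else 0) ≤ ENNReal.ofReal (4 / √T) := by
  refine ENNReal.tsum_le_of_sum_range_le fun M => ?_
  rw [← ENNReal.ofReal_sum_of_nonneg fun n _ => by split_ifs <;> positivity]
  refine ENNReal.ofReal_le_ofReal ?_
  set g : ℕ → ℝ := fun n => 4 / √(max ((n + 2 : ℕ) : ℝ) T) with hg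
  have hterm : ∀ n : ℕ, (if T ≤ ((n + 2 : ℕ) : ℝ) then
      1 / (((n + 2 : ℕ) : ℝ) * √((n + 2 : ℕ) : ℝ)) else 0) ≤ g n - g (n + 1) := by
    intro n
    have hcast : ((n + 1 + 2 : ℕ) : ℝ) = ((n + 2 : ℕ) : ℝ) + 1 := by push_cast; ring
    split_ifs with h
    · have := one_div_mul_sqrt_le (x := ((n + 2 : ℕ) : ℝ))
        (by push_cast; linarith [(Nat.cast_nonneg n : (0 : ℝ) ≤ n)])
      simp only [hg, hcast, max_eq_left h, max_eq_left (h.trans (le_add_of_nonneg_right zero_le_one))]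
      convert this using 1
      ring
    · have : g (n + 1) ≤ g n := by
        have : 0 < √(max ((n + 2 : ℕ) : ℝ) T) := Real.sqrt_pos.2 (lt_max_of_lt_right hT)
        simp only [hg, hcast]
        gcongr
        linarith
      linarith
  have hM : 0 ≤ g M := by positivity
  calc _ ≤ ∑ n ∈ Finset.range M, (g n - g (n + 1)) := Finset.sum_le_sum fun n _ => hterm n
    _ = g 0 - g M := Finset.sum_range_sub' g M
    _ ≤ g 0 := by linarith
    _ ≤ 4 / √T := by
      have : 0 < √T := Real.sqrt_pos.2 hT
      simp only [hg]
      gcongr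
      exact le_max_right _ _

lemma log_rpow_div_sqrt_le {θ T x : ℝ} (hθ : 0 < θ) (hT : Real.exp (4 * θ) ≤ T) (hx : T ≤ x) :
    Real.log x ^ (2 * θ) / √x ≤ Real.log T ^ (2 * θ) / √T := by
  have hT1 : 1 ≤ T := (Real.one_le_exp (by positivity)).trans hT
  have hpow : ∀ z : ℝ, 1 ≤ z →
      (Real.log z / z ^ (1 / (4 * θ))) ^ (2 * θ) = Real.log z ^ (2 * θ) / √z := by
    intro z hz
    rw [Real.div_rpow (Real.log_nonneg hz) (by positivity), ← Real.rpow_mul (by linarith),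
      Real.sqrt_eq_rpow]
    congr 2
    field_simp
    norm_num
  rw [← hpow x (hT1.trans hx), ← hpow T hT1]
  have hanti := Real.log_div_self_rpow_antitoneOn (a := 1 / (4 * θ)) (by positivity)
  refine Real.rpow_le_rpow (div_nonneg (Real.log_nonneg (hT1.trans hx))
    (Real.rpow_nonneg (by linarith) _))
    (hanti ?_ ?_ hx) (by positivity)
  · simpa using hT
  · simpa using hT.trans hx

lemma summable_logWeight (θ : ℝ) : Summable (logWeight θ) := by
  have ho := (isLittleO_log_rpow_rpow_atTop (2 * θ) (one_half_pos : (0 : ℝ) < 1 / 2)).isBigO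
  have hlim : Tendsto (fun n : ℕ => ((n : ℕ) : ℝ)) atTop atTop := tendsto_natCast_atTop_atTop
  have hs : Summable fun n : ℕ => (n : ℝ) ^ (-(3 / 2) : ℝ) :=
    Real.summable_nat_rpow.2 (by norm_num)
  have hb := (Asymptotics.isBigO_refl (fun n : ℕ => (n : ℝ) ^ (-(2 : ℝ))) atTop).mul
    (ho.comp_tendsto hlim)
  have hmain : Summable fun n : ℕ => (n : ℝ) ^ (-(2 : ℝ)) * Real.log (n : ℝ) ^ (2 * θ) := by
    refine summable_of_isBigO_nat hs (hb.congr' .rfl ?_)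
    filter_upwards [eventually_gt_atTop 0] with n hn
    simp only [Function.comp]
    rw [← Real.rpow_add (by positivity)]
    norm_num
  exact (summable_nat_add_iff 2).2 hmain

lemma logWeightTail_le_tsum (θ y : ℝ) :
    logWeightTail θ y ≤ ∑' n, ENNReal.ofReal (logWeight θ n) :=
  ENNReal.tsum_le_tsum fun n => by split_ifs <;> simp

lemma eventually_log_rpow_le (θ : ℝ) {c : ℝ} (hc : 0 < c) :
    ∀ᶠ y : ℝ in atTop, Real.log y ^ θ ≤ c * y := by
  filter_upwards [(isLittleO_log_rpow_rpow_atTop θ (one_pos : (0 : ℝ) < 1)).bound hc,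
    eventually_ge_atTop 0] with y hy h0
  simpa [abs_of_nonneg h0] using (le_abs_self _).trans hy

lemma eventually_sq_mul_logWeightTail_le {θ : ℝ} (hθ : 0 < θ) :
    ∀ᶠ y : ℝ in atTop, ENNReal.ofReal (y ^ 2) * logWeightTail θ y ≤
      ENNReal.ofReal (4 * 2 ^ (2 * θ)) * ENNReal.ofReal (y * Real.log y ^ θ) := by
  filter_upwards [eventually_log_rpow_le θ one_pos, eventually_ge_atTop (Real.exp (4 * θ)),
    eventually_ge_atTop (Real.exp 1), eventually_gt_atTop (2 / Real.log 2 ^ θ)]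
    with y hlog hyθ hy1 hy2
  have hy0 : 0 < y := (Real.exp_pos 1).trans_le hy1
  have hl : 1 ≤ Real.log y := (Real.le_log_iff_exp_le hy0).2 hy1
  have hlθ : 1 ≤ Real.log y ^ θ := Real.one_le_rpow hl hθ.le
  set T := y * Real.log y ^ θ with hT
  have hyT : y ≤ T := le_mul_of_one_le_right hy0.le hlθ
  have hT0 : 0 < T := hy0.trans_le hyT
  have hlT : Real.log T ≤ 2 * Real.log y := by
    rw [← Nat.cast_ofNat (R := ℝ), ← Real.log_pow]
    exact Real.log_le_log hT0 (by rw [hT]; nlinarith)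
  have hlT0 : 0 ≤ Real.log T := Real.log_nonneg (by linarith [Real.add_one_le_exp 1])
  have hA0 : 0 ≤ Real.log T ^ (2 * θ) / √T := by positivity
  have hterm : ∀ n : ℕ, (if y ≤ ((n + 2 : ℕ) : ℝ) * Real.log ((n + 2 : ℕ) : ℝ) ^ (-θ) then
      ENNReal.ofReal (logWeight θ n) else 0) ≤ ENNReal.ofReal (Real.log T ^ (2 * θ) / √T) *
        ENNReal.ofReal (if T ≤ ((n + 2 : ℕ) : ℝ) then
          1 / (((n + 2 : ℕ) : ℝ) * √((n + 2 : ℕ) : ℝ)) else 0) := by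
    intro n
    split_ifs with h h' h'
    · rw [← ENNReal.ofReal_mul hA0]
      refine ENNReal.ofReal_le_ofReal ?_
      have h0 : (0 : ℝ) < ((n + 2 : ℕ) : ℝ) := by positivity
      have := log_rpow_div_sqrt_le hθ (hyθ.trans hyT) h'
      calc logWeight θ n = Real.log ((n + 2 : ℕ) : ℝ) ^ (2 * θ) / √((n + 2 : ℕ) : ℝ) *
            (1 / (((n + 2 : ℕ) : ℝ) * √((n + 2 : ℕ) : ℝ))) := by
            have hs := Real.sq_sqrt h0.le
            rw [logWeight_eq_div, div_mul_div_comm, mul_one]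
            congr 1
            linear_combination -((n + 2 : ℕ) : ℝ) * hs
        _ ≤ _ := by gcongr
    · exfalso
      rw [le_mul_log_rpow_neg_iff] at h
      rcases Nat.eq_zero_or_pos n with rfl | hn
      · have : 0 < Real.log 2 ^ θ := Real.rpow_pos_of_pos (Real.log_pos one_lt_two) _
        rw [div_lt_iff₀ this] at hy2
        norm_num at h
        linarith
      · have hn3 : (3 : ℝ) ≤ ((n + 2 : ℕ) : ℝ) := by exact_mod_cast (by omega : 3 ≤ n + 2)
        have hL1 : 1 ≤ Real.log ((n + 2 : ℕ) : ℝ) :=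
          (Real.le_log_iff_exp_le (by positivity)).2
            (by linarith [Real.exp_one_lt_d9])
        have hyn : y ≤ ((n + 2 : ℕ) : ℝ) :=
          (le_mul_of_one_le_right hy0.le (Real.one_le_rpow hL1 hθ.le)).trans h
        have hLy := Real.log_le_log hy0 hyn
        refine h' (le_trans ?_ h)
        rw [hT]
        gcongr
    · simp
    · simp
  calc ENNReal.ofReal (y ^ 2) * logWeightTail θ y
      ≤ ENNReal.ofReal (y ^ 2) * (ENNReal.ofReal (Real.log T ^ (2 * θ) / √T) *
        ENNReal.ofReal (4 / √T)) := by
        gcongr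
        refine (ENNReal.tsum_le_tsum hterm).trans ?_
        rw [ENNReal.tsum_mul_left]
        gcongr
        exact tsum_one_div_mul_sqrt_tail_le hT0
    _ = ENNReal.ofReal (y ^ 2 * (Real.log T ^ (2 * θ) / √T * (4 / √T))) := by
        rw [← ENNReal.ofReal_mul hA0, ← ENNReal.ofReal_mul (by positivity)]
    _ ≤ ENNReal.ofReal (4 * 2 ^ (2 * θ) * T) := by
        refine ENNReal.ofReal_le_ofReal ?_
        have hp : Real.log T ^ (2 * θ) ≤ 2 ^ (2 * θ) * (Real.log y ^ θ) ^ 2 := by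
          calc Real.log T ^ (2 * θ) ≤ (2 * Real.log y) ^ (2 * θ) := by gcongr
            _ = _ := by
              rw [Real.mul_rpow (by norm_num) (by linarith), mul_comm 2 θ,
                Real.rpow_mul (x := Real.log y) (by linarith), Real.rpow_ofNat]
        calc y ^ 2 * (Real.log T ^ (2 * θ) / √T * (4 / √T))
            = 4 * y ^ 2 * Real.log T ^ (2 * θ) / T := by
              rw [div_mul_div_comm, Real.mul_self_sqrt hT0.le]; ring
          _ ≤ 4 * y ^ 2 * (2 ^ (2 * θ) * (Real.log y ^ θ) ^ 2) / T := by gcongr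
          _ = 4 * 2 ^ (2 * θ) * T := by
              rw [div_eq_iff hT0.ne', hT]; ring
    _ = _ := ENNReal.ofReal_mul (by positivity)

lemma eventually_le_sq_mul_logWeightTail {θ : ℝ} (hθ : 0 < θ) :
    ∀ᶠ y : ℝ in atTop, ENNReal.ofReal (y * Real.log y ^ θ) ≤
      ENNReal.ofReal (8 * 2 ^ θ) * (ENNReal.ofReal (y ^ 2) * logWeightTail θ y) := by
  have h2 : (1 : ℝ) ≤ 2 ^ θ := Real.one_le_rpow one_le_two hθ.le
  filter_upwards [eventually_log_rpow_le θ (c := 1 / (4 * 2 ^ θ)) (by positivity),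
    eventually_ge_atTop (Real.exp 1)] with y hlog hy1
  have hy0 : 0 < y := (Real.exp_pos 1).trans_le hy1
  have hye : 2 ≤ y := by linarith [Real.add_one_le_exp 1]
  have hl : 1 ≤ Real.log y := (Real.le_log_iff_exp_le hy0).2 hy1
  have hlθ : 1 ≤ Real.log y ^ θ := Real.one_le_rpow hl hθ.le
  set T := 2 ^ θ * (y * Real.log y ^ θ) with hT
  have hyT : y ≤ T := by
    have := le_mul_of_one_le_right hy0.le hlθ
    nlinarith
  have hT4 : 4 * T ≤ y ^ 2 := by
    calc 4 * T ≤ 4 * (2 ^ θ * (y * (1 / (4 * 2 ^ θ) * y))) := by rw [hT]; gcongr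
      _ = y ^ 2 := by field_simp
  set K := ⌈T⌉₊ with hK
  have hTK : T ≤ K := Nat.le_ceil T
  have hK2 : (K : ℝ) ≤ 2 * T := by linarith [Nat.ceil_lt_add_one (hy0.le.trans hyT)]
  have hK0 : (0 : ℝ) < K := by linarith
  have hKnat : 2 ≤ K := by exact_mod_cast hye.trans (hyT.trans hTK)
  have hterm : ∀ n ∈ Finset.Ico (K - 2) (2 * K - 2),
      ENNReal.ofReal ((Real.log y ^ θ) ^ 2 / (2 * K) ^ 2) ≤
      (if y ≤ ((n + 2 : ℕ) : ℝ) * Real.log ((n + 2 : ℕ) : ℝ) ^ (-θ) then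
      ENNReal.ofReal (logWeight θ n) else 0) := by
    intro n hn
    rw [Finset.mem_Ico] at hn
    have hKn : (K : ℝ) ≤ ((n + 2 : ℕ) : ℝ) := by exact_mod_cast (by omega : K ≤ n + 2)
    have hnK : ((n + 2 : ℕ) : ℝ) ≤ 2 * K := by exact_mod_cast (by omega : n + 2 ≤ 2 * K)
    have hn0 : (0 : ℝ) < ((n + 2 : ℕ) : ℝ) := by positivity
    have hLy : Real.log y ≤ Real.log ((n + 2 : ℕ) : ℝ) := Real.log_le_log hy0 (by linarith)
    have hL2 : Real.log ((n + 2 : ℕ) : ℝ) ≤ 2 * Real.log y := by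
      rw [← Nat.cast_ofNat (R := ℝ), ← Real.log_pow]
      exact Real.log_le_log hn0 (by linarith)
    rw [if_pos]
    · refine ENNReal.ofReal_le_ofReal ?_
      rw [logWeight_eq_div, mul_comm 2 θ, Real.rpow_mul (by linarith), Real.rpow_ofNat]
      gcongr
    · rw [le_mul_log_rpow_neg_iff]
      calc y * Real.log ((n + 2 : ℕ) : ℝ) ^ θ ≤ y * (2 * Real.log y) ^ θ := by gcongr
        _ = T := by rw [Real.mul_rpow (by norm_num) (by linarith), hT]; ring
        _ ≤ _ := hTK.trans hKn
  have hsum : ENNReal.ofReal ((Real.log y ^ θ) ^ 2 / (4 * K)) ≤ logWeightTail θ y := by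
    refine le_trans ?_ (ENNReal.sum_le_tsum (Finset.Ico (K - 2) (2 * K - 2)))
    refine le_trans (le_of_eq ?_) (Finset.card_nsmul_le_sum _ _ _ hterm)
    rw [Nat.card_Ico, show 2 * K - 2 - (K - 2) = K by omega, nsmul_eq_mul,
      ← ENNReal.ofReal_natCast, ← ENNReal.ofReal_mul hK0.le]
    congr 1
    field_simp
    norm_num
  calc ENNReal.ofReal (y * Real.log y ^ θ)
      ≤ ENNReal.ofReal (8 * 2 ^ θ * (y ^ 2 * ((Real.log y ^ θ) ^ 2 / (4 * K)))) := by
        refine ENNReal.ofReal_le_ofReal ?_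
        calc y * Real.log y ^ θ
            = 8 * 2 ^ θ * (y ^ 2 * ((Real.log y ^ θ) ^ 2 / (4 * (2 * T)))) := by
              rw [hT]; field_simp; norm_num
          _ ≤ _ := by gcongr
    _ = ENNReal.ofReal (8 * 2 ^ θ) * (ENNReal.ofReal (y ^ 2) *
          ENNReal.ofReal ((Real.log y ^ θ) ^ 2 / (4 * K))) := by
        rw [ENNReal.ofReal_mul (p := 8 * 2 ^ θ) (by positivity),
          ENNReal.ofReal_mul (p := y ^ 2) (by positivity)]
    _ ≤ _ := by gcongr

lemma exists_sq_mul_logWeightTail_le {θ : ℝ} (hθ : 0 < θ) :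
    ∃ A B : ℝ≥0∞, A ≠ ⊤ ∧ B ≠ ⊤ ∧ ∀ y : ℝ, 0 ≤ y →
      ENNReal.ofReal (y ^ 2) * logWeightTail θ y ≤
        A + B * ENNReal.ofReal (y * max (Real.log y) 0 ^ θ) := by
  obtain ⟨y₀, h₀⟩ := eventually_atTop.1
    ((eventually_sq_mul_logWeightTail_le hθ).and (eventually_ge_atTop 1))
  refine ⟨ENNReal.ofReal (y₀ ^ 2) * ∑' n, ENNReal.ofReal (logWeight θ n),
    ENNReal.ofReal (4 * 2 ^ (2 * θ)),
    ENNReal.mul_ne_top ENNReal.ofReal_ne_top (summable_logWeight θ).tsum_ofReal_ne_top,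
    ENNReal.ofReal_ne_top, fun y hy => ?_⟩
  rcases le_total y₀ y with h | h
  · rw [max_eq_left (Real.log_nonneg (h₀ y h).2)]
    exact (h₀ y h).1.trans le_add_self
  · refine le_add_right ?_
    gcongr
    exact logWeightTail_le_tsum θ y

lemma exists_le_sq_mul_logWeightTail {θ : ℝ} (hθ : 0 < θ) :
    ∃ A B : ℝ≥0∞, A ≠ ⊤ ∧ B ≠ ⊤ ∧ ∀ y : ℝ, 0 ≤ y →
      ENNReal.ofReal (y * max (Real.log y) 0 ^ θ) ≤
        A + B * (ENNReal.ofReal (y ^ 2) * logWeightTail θ y) := by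
  obtain ⟨y₀, h₀⟩ := eventually_atTop.1
    ((eventually_le_sq_mul_logWeightTail hθ).and (eventually_ge_atTop 1))
  refine ⟨ENNReal.ofReal (y₀ * max (Real.log y₀) 0 ^ θ), ENNReal.ofReal (8 * 2 ^ θ),
    ENNReal.ofReal_ne_top, ENNReal.ofReal_ne_top, fun y hy => ?_⟩
  rcases le_total y₀ y with h | h
  · rw [max_eq_left (Real.log_nonneg (h₀ y h).2)]
    exact (h₀ y h).1.trans le_add_self
  · refine le_add_right (ENNReal.ofReal_le_ofReal ?_)
    rcases hy.eq_or_lt with rfl | hy'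
    · rw [zero_mul]
      positivity
    · have := Real.log_le_log hy' h
      have := hy.trans h
      gcongr

/-- For a real random variable `Y` and `θ > 0`,
`∑_{n ≥ 2} n^{-2} (log n)^{2θ} E[Y² 1_{|Y| ≤ n (log n)^{-θ}}] < ∞` if and only if
`E[|Y| (log⁺ |Y|)^θ] < ∞`. -/
theorem tsum_truncated_second_moment_lt_top_iff
    {Ω : Type*} [MeasureSpace Ω] [IsProbabilityMeasure (ℙ : Measure Ω)]
    (Y : Ω → ℝ) (hYmeas : Measurable Y)
    (θ : ℝ) (hθ : 0 < θ) :
    (∑' n : ℕ,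
        ENNReal.ofReal (((n + 2 : ℕ) : ℝ) ^ (-(2 : ℝ)) * Real.log ((n + 2 : ℕ) : ℝ) ^ (2 * θ)) *
          ∫⁻ ω in {ω | |Y ω| ≤ ((n + 2 : ℕ) : ℝ) * Real.log ((n + 2 : ℕ) : ℝ) ^ (-θ)},
            ENNReal.ofReal (Y ω ^ 2) ∂ℙ < ⊤)
      ↔ ∫⁻ ω, ENNReal.ofReal (|Y ω| * max (Real.log |Y ω|) 0 ^ θ) ∂ℙ < ⊤ := by
  have hset : ∀ c : ℝ, MeasurableSet {ω | |Y ω| ≤ c} := fun c =>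
    measurableSet_le (by fun_prop) measurable_const
  have hsum : (∑' n : ℕ,
        ENNReal.ofReal (((n + 2 : ℕ) : ℝ) ^ (-(2 : ℝ)) * Real.log ((n + 2 : ℕ) : ℝ) ^ (2 * θ)) *
          ∫⁻ ω in {ω | |Y ω| ≤ ((n + 2 : ℕ) : ℝ) * Real.log ((n + 2 : ℕ) : ℝ) ^ (-θ)},
            ENNReal.ofReal (Y ω ^ 2) ∂ℙ) =
      ∫⁻ ω, ENNReal.ofReal (|Y ω| ^ 2) * logWeightTail θ |Y ω| ∂ℙ := by
    simp only [logWeightTail, ← ENNReal.tsum_mul_left]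
    rw [lintegral_tsum fun n => by
      refine ((by fun_prop : Measurable fun ω => ENNReal.ofReal (|Y ω| ^ 2)).mul
        (Measurable.ite (hset _) measurable_const measurable_const)).aemeasurable]
    refine tsum_congr fun n => ?_
    rw [← lintegral_indicator (hset _), ← lintegral_const_mul _
      ((by fun_prop : Measurable fun ω => ENNReal.ofReal (Y ω ^ 2)).indicator (hset _))]
    refine lintegral_congr fun ω => ?_
    simp only [Set.indicator_apply, Set.mem_ofPred_eq, sq_abs, logWeight]
    split_ifs
    · rw [mul_comm]
    · simp
  have hdom : ∀ {f g : Ω → ℝ≥0∞} {A B : ℝ≥0∞}, A ≠ ⊤ → B ≠ ⊤ → (∀ ω, f ω ≤ A + B * g ω) →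
      ∫⁻ ω, g ω ∂ℙ < ⊤ → ∫⁻ ω, f ω ∂ℙ < ⊤ := by
    intro f g A B hA hB hfg hg
    calc ∫⁻ ω, f ω ∂ℙ ≤ ∫⁻ ω, (A + B * g ω) ∂ℙ := lintegral_mono hfg
      _ = A + B * ∫⁻ ω, g ω ∂ℙ := by
        rw [lintegral_add_left measurable_const, lintegral_const_mul' _ _ hB]
        simp
      _ < ⊤ := ENNReal.add_lt_top.2 ⟨hA.lt_top, ENNReal.mul_lt_top hB.lt_top hg⟩
  rw [hsum]
  obtain ⟨A, B, hA, hB, hAB⟩ := exists_le_sq_mul_logWeightTail hθ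
  obtain ⟨A', B', hA', hB', hAB'⟩ := exists_sq_mul_logWeightTail_le hθ
  exact ⟨hdom hA hB fun ω => hAB _ (abs_nonneg _), hdom hA' hB' fun ω => hAB' _ (abs_nonneg _)⟩
end

section
/- Let X be an integrable nonnegative real random variable and γ > 0. Then lim_{n→∞} (log n)^γ · Σ_{k≥n} k^{-1} E[X 1_{X > k (log k)^{-γ}}] = 0 if and only if lim_{t→∞} (log t)^γ · E[X (log X − log t) 1_{X > t}] = 0. -/
open MeasureTheory ProbabilityTheory Filter
open scoped ENNReal NNReal

namespace TruncatedMoment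

/-- The threshold `k (log k)^{-γ}`. -/
noncomputable def threshold (γ : ℝ) (k : ℝ) : ℝ := k * Real.log k ^ (-γ)

/-- The truncated moment `E[X (log X - log t) 1_{X > t}]`. -/
noncomputable def logMoment {Ω : Type*} [MeasureSpace Ω] (X : Ω → ℝ) (t : ℝ) : ℝ≥0∞ :=
  ∫⁻ ω in {ω | t < X ω}, ENNReal.ofReal (X ω * (Real.log (X ω) - Real.log t)) ∂ℙ

/-- The tail sum `∑_{k ≥ n, k ≥ 2} k⁻¹ E[X 1_{X > k (log k)^{-γ}}]`. -/
noncomputable def tailSum {Ω : Type*} [MeasureSpace Ω] (X : Ω → ℝ) (γ : ℝ) (n : ℕ) : ℝ≥0∞ :=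
  ∑' k : ℕ, (if 2 ≤ k ∧ n ≤ k then
    ((k : ℝ≥0∞))⁻¹ *
      ∫⁻ ω in {ω | (k : ℝ) * Real.log (k : ℝ) ^ (-γ) < X ω}, ENNReal.ofReal (X ω) ∂ℙ
  else 0)

/-- The summand `k⁻¹ 1_{k (log k)^{-γ} < x}` of the harmonic sum below level `x`. -/
noncomputable def levelTerm (γ x : ℝ) (k : ℕ) : ℝ :=
  if threshold γ k < x then (k : ℝ)⁻¹ else 0

lemma levelTerm_nonneg (γ x : ℝ) (k : ℕ) : 0 ≤ levelTerm γ x k := by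
  unfold levelTerm; split_ifs <;> positivity

section Threshold

variable {γ a b : ℝ}

lemma one_lt_of_one_le_log (ha0 : 0 < a) (ha : 1 ≤ Real.log a) : 1 < a :=
  (Real.log_pos_iff ha0.le).1 (by linarith)

lemma threshold_pos (ha0 : 0 < a) (ha : 1 ≤ Real.log a) : 0 < threshold γ a :=
  mul_pos ha0 (Real.rpow_pos_of_pos (by linarith) _)

lemma log_threshold (ha0 : 0 < a) (ha : 1 ≤ Real.log a) :
    Real.log (threshold γ a) = Real.log a - γ * Real.log (Real.log a) := by
  have hl : 0 < Real.log a := by linarith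
  rw [threshold, Real.log_mul ha0.ne' (Real.rpow_pos_of_pos hl _).ne', Real.log_rpow hl]
  ring

lemma threshold_le_self (hγ : 0 < γ) (ha0 : 0 < a) (ha : 1 ≤ Real.log a) :
    threshold γ a ≤ a :=
  mul_le_of_le_one_right ha0.le (Real.rpow_le_one_of_one_le_of_nonpos ha (by linarith))

lemma log_threshold_sub_le (hγ : 0 < γ) (ha0 : 0 < a) (ha : 1 ≤ Real.log a) (hab : a ≤ b) :
    Real.log (threshold γ b) - Real.log (threshold γ a) ≤ Real.log b - Real.log a := by
  have hlog : Real.log a ≤ Real.log b := Real.log_le_log ha0 hab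
  rw [log_threshold ha0 ha, log_threshold (ha0.trans_le hab) (ha.trans hlog)]
  have : Real.log (Real.log a) ≤ Real.log (Real.log b) := Real.log_le_log (by linarith) hlog
  nlinarith

lemma log_sub_le_two_mul_log_threshold_sub (hγ : 0 < γ) (ha0 : 0 < a) (ha : 1 ≤ Real.log a)
    (haγ : 2 * γ ≤ Real.log a) (hab : a ≤ b) :
    Real.log b - Real.log a ≤ 2 * (Real.log (threshold γ b) - Real.log (threshold γ a)) := by
  have hlog : Real.log a ≤ Real.log b := Real.log_le_log ha0 hab
  have hpos : 0 < Real.log a := by linarith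
  rw [log_threshold ha0 ha, log_threshold (ha0.trans_le hab) (ha.trans hlog)]
  have hquot : Real.log (Real.log b) - Real.log (Real.log a) ≤
      (Real.log b - Real.log a) / Real.log a := by
    rw [← Real.log_div (by linarith) hpos.ne', sub_div, div_self hpos.ne']
    exact Real.log_le_sub_one_of_pos (div_pos (by linarith) hpos)
  have hmul : 2 * γ * ((Real.log b - Real.log a) / Real.log a) ≤ Real.log b - Real.log a := by
    rw [mul_div_assoc', div_le_iff₀ hpos]
    nlinarith
  nlinarith

lemma log_threshold_mono (hγ : 0 < γ) (ha0 : 0 < a) (ha : 1 ≤ Real.log a)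
    (haγ : 2 * γ ≤ Real.log a) (hab : a ≤ b) :
    Real.log (threshold γ a) ≤ Real.log (threshold γ b) := by
  have := log_sub_le_two_mul_log_threshold_sub hγ ha0 ha haγ hab
  have := Real.log_le_log ha0 hab
  linarith

lemma eventually_log_le_two_mul_log_threshold (γ : ℝ) :
    ∀ᶠ k : ℝ in atTop, Real.log k ≤ 2 * Real.log (threshold γ k) := by
  have hlo : (fun k : ℝ => γ * Real.log (Real.log k)) =o[atTop] fun k => Real.log k :=
    (Real.isLittleO_log_id_atTop.comp_tendsto Real.tendsto_log_atTop).const_mul_left γ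
  filter_upwards [hlo.bound (by norm_num : (0 : ℝ) < 1 / 2), eventually_gt_atTop 0,
    Real.tendsto_log_atTop.eventually_ge_atTop 1] with k hk hk0 hk1
  rw [log_threshold hk0 hk1]
  rw [Real.norm_eq_abs, Real.norm_eq_abs, abs_of_nonneg (by linarith : 0 ≤ Real.log k)] at hk
  linarith [le_abs_self (γ * Real.log (Real.log k))]

lemma tendsto_log_threshold_atTop (γ : ℝ) :
    Tendsto (fun k : ℝ => Real.log (threshold γ k)) atTop atTop := by
  refine tendsto_atTop_mono' _ ?_ (Real.tendsto_log_atTop.const_mul_atTop (r := 1 / 2) (by norm_num))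
  filter_upwards [eventually_log_le_two_mul_log_threshold γ] with k hk
  linarith

lemma tendsto_threshold_atTop (γ : ℝ) : Tendsto (threshold γ) atTop atTop := by
  refine tendsto_atTop_mono' _ ?_
    (Real.tendsto_exp_atTop.comp (tendsto_log_threshold_atTop γ))
  filter_upwards [eventually_gt_atTop 0,
    Real.tendsto_log_atTop.eventually_ge_atTop 1] with k hk0 hk1
  exact (Real.exp_log (threshold_pos hk0 hk1)).le

end Threshold

section HarmonicSum

variable {γ x : ℝ} {n : ℕ}

lemma log_succ_sub_log_le {k : ℕ} (hk : 0 < k) :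
    Real.log (k + 1 : ℕ) - Real.log k ≤ (k : ℝ)⁻¹ := by
  have hk' : (0 : ℝ) < k := by exact_mod_cast hk
  rw [← Real.log_div (by positivity) hk'.ne']
  refine (Real.log_le_sub_one_of_pos (by positivity)).trans (le_of_eq ?_)
  push_cast
  field_simp
  ring

lemma inv_succ_le_log_sub {k : ℕ} (hk : 0 < k) :
    ((k + 1 : ℕ) : ℝ)⁻¹ ≤ Real.log (k + 1 : ℕ) - Real.log k := by
  have hk' : (0 : ℝ) < k := by exact_mod_cast hk
  have hlog : Real.log ((k : ℝ) / (k + 1 : ℕ)) ≤ (k : ℝ) / (k + 1 : ℕ) - 1 :=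
    Real.log_le_sub_one_of_pos (by positivity)
  rw [Real.log_div hk'.ne' (by positivity)] at hlog
  have : (k : ℝ) / (k + 1 : ℕ) - 1 = -((k + 1 : ℕ) : ℝ)⁻¹ := by
    push_cast
    field_simp
    ring
  linarith

lemma min_sub_min_le_sum_levelTerm (hγ : 0 < γ) (hx : 0 < x) (hn0 : 0 < n) (hn : 1 ≤ Real.log n)
    (m : ℕ) :
    min (Real.log (threshold γ (n + m : ℕ))) (Real.log x) -
      min (Real.log (threshold γ n)) (Real.log x) ≤
    ∑ k ∈ Finset.Ico n (n + m), levelTerm γ x k := by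
  induction m with
  | zero => simp
  | succ m ih =>
    rw [← add_assoc, Finset.sum_Ico_succ_top (by omega)]
    have hk0 : 0 < n + m := by omega
    have hk1 : 1 ≤ Real.log (n + m : ℕ) :=
      hn.trans (Real.log_le_log (by exact_mod_cast hn0) (by exact_mod_cast n.le_add_right m))
    have hstep := log_threshold_sub_le hγ (by exact_mod_cast hk0) hk1
      (show ((n + m : ℕ) : ℝ) ≤ (n + m + 1 : ℕ) by exact_mod_cast (n + m).le_succ)
    have hinv := log_succ_sub_log_le hk0
    have hpos : (0 : ℝ) < ((n + m : ℕ) : ℝ)⁻¹ := by positivity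
    have hthr : 0 < threshold γ (n + m : ℕ) :=
      threshold_pos (by exact_mod_cast hk0) hk1
    suffices min (Real.log (threshold γ (n + m + 1 : ℕ))) (Real.log x) -
        min (Real.log (threshold γ (n + m : ℕ))) (Real.log x) ≤ levelTerm γ x (n + m) by
      linarith
    unfold levelTerm
    split_ifs with h
    · have := Real.log_le_log hthr h.le
      rw [min_eq_left this]
      linarith [min_le_left (Real.log (threshold γ (n + m + 1 : ℕ))) (Real.log x)]
    · have := Real.log_le_log hx (not_lt.1 h)
      rw [min_eq_right this]
      linarith [min_le_right (Real.log (threshold γ (n + m + 1 : ℕ))) (Real.log x)]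

lemma sum_levelTerm_le (hγ : 0 < γ) (hn0 : 0 < n) (hn : 1 ≤ Real.log n)
    (hnγ : 2 * γ ≤ Real.log n) (m : ℕ) :
    ∑ k ∈ Finset.Ico n (n + m + 1), levelTerm γ x k ≤
      (n : ℝ)⁻¹ + 2 * (min (Real.log (threshold γ (n + m : ℕ))) (Real.log x) -
        min (Real.log (threshold γ n)) (Real.log x)) := by
  induction m with
  | zero =>
    simp only [add_zero, Nat.Ico_succ_singleton, Finset.sum_singleton, sub_self, mul_zero]
    unfold levelTerm
    split_ifs <;> first | exact le_rfl | positivity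
  | succ m ih =>
    rw [Finset.sum_Ico_succ_top (by omega), ← add_assoc]
    have hk0 : 0 < n + m := by omega
    have hlog : Real.log n ≤ Real.log (n + m : ℕ) :=
      Real.log_le_log (by exact_mod_cast hn0) (by exact_mod_cast n.le_add_right m)
    have hk0' : (0 : ℝ) < (n + m : ℕ) := by exact_mod_cast hk0
    have hle : ((n + m : ℕ) : ℝ) ≤ (n + m + 1 : ℕ) := by exact_mod_cast (n + m).le_succ
    have hstep := log_sub_le_two_mul_log_threshold_sub hγ hk0' (hn.trans hlog)
      (hnγ.trans hlog) hle
    have hmono := log_threshold_mono hγ hk0' (hn.trans hlog) (hnγ.trans hlog) hle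
    have hinv := inv_succ_le_log_sub hk0
    suffices levelTerm γ x (n + m + 1) ≤
        2 * (min (Real.log (threshold γ (n + m + 1 : ℕ))) (Real.log x) -
          min (Real.log (threshold γ (n + m : ℕ))) (Real.log x)) by
      linarith
    unfold levelTerm
    split_ifs with h
    · have hthr : 0 < threshold γ (n + m + 1 : ℕ) :=
        threshold_pos (hk0'.trans_le hle) ((hn.trans hlog).trans (Real.log_le_log hk0' hle))
      rw [min_eq_left (Real.log_le_log hthr h.le)]
      linarith [min_le_left (Real.log (threshold γ (n + m : ℕ))) (Real.log x)]
    · linarith [min_le_min_right (Real.log x) hmono]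

lemma levelTerm_eq_zero (hγ : 0 < γ) (hn0 : 0 < n) (hn : 1 ≤ Real.log n)
    (hnγ : 2 * γ ≤ Real.log n) (hx : x ≤ threshold γ n) {k : ℕ} (hk : n ≤ k) :
    levelTerm γ x k = 0 := by
  have hn0' : (0 : ℝ) < n := by exact_mod_cast hn0
  have hnk : (n : ℝ) ≤ k := by exact_mod_cast hk
  have hmono := log_threshold_mono hγ hn0' hn hnγ hnk
  rw [Real.log_le_log_iff (threshold_pos hn0' hn)
    (threshold_pos (hn0'.trans_le hnk) (hn.trans (Real.log_le_log hn0' hnk)))] at hmono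
  exact if_neg (not_lt.2 (hx.trans hmono))

/-- The harmonic sum `∑_{k ≥ n, k (log k)^{-γ} < x} k⁻¹`. -/
noncomputable def levelSum (γ : ℝ) (n : ℕ) (x : ℝ) : ℝ≥0∞ :=
  ∑' k : ℕ, if n ≤ k then ENNReal.ofReal (levelTerm γ x k) else 0

lemma sum_ite_ofReal_levelTerm (N : ℕ) :
    ∑ k ∈ Finset.range N, (if n ≤ k then ENNReal.ofReal (levelTerm γ x k) else 0) =
      ENNReal.ofReal (∑ k ∈ Finset.Ico n N, levelTerm γ x k) := by
  rw [← Finset.sum_filter, ENNReal.ofReal_sum_of_nonneg fun k _ => levelTerm_nonneg γ x k]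
  congr 1
  ext k
  simp [and_comm]

lemma levelSum_le (hγ : 0 < γ) (hn0 : 0 < n) (hn : 1 ≤ Real.log n)
    (hnγ : 2 * γ ≤ Real.log n) (hx : threshold γ n < x) :
    levelSum γ n x ≤
      ENNReal.ofReal (n : ℝ)⁻¹ + 2 * ENNReal.ofReal (Real.log x - Real.log (threshold γ n)) := by
  have hthr : 0 < threshold γ n := threshold_pos (by exact_mod_cast hn0) hn
  have hlog := Real.log_le_log hthr hx.le
  have htwo : (2 : ℝ≥0∞) = ENNReal.ofReal 2 := by simp
  rw [htwo, ← ENNReal.ofReal_mul (by norm_num), ← ENNReal.ofReal_add (by positivity)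
    (by linarith)]
  refine ENNReal.tsum_le_of_sum_range_le fun N => ?_
  rw [sum_ite_ofReal_levelTerm]
  refine ENNReal.ofReal_le_ofReal ?_
  calc ∑ k ∈ Finset.Ico n N, levelTerm γ x k
      ≤ ∑ k ∈ Finset.Ico n (n + N + 1), levelTerm γ x k :=
        Finset.sum_le_sum_of_subset_of_nonneg (Finset.Ico_subset_Ico_right (by omega))
          fun k _ _ => levelTerm_nonneg γ x k
    _ ≤ _ := sum_levelTerm_le hγ hn0 hn hnγ N
    _ ≤ _ := by
        rw [min_eq_left hlog]
        linarith [min_le_right (Real.log (threshold γ (n + N : ℕ))) (Real.log x)]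

lemma levelSum_eq_zero (hγ : 0 < γ) (hn0 : 0 < n) (hn : 1 ≤ Real.log n)
    (hnγ : 2 * γ ≤ Real.log n) (hx : x ≤ threshold γ n) : levelSum γ n x = 0 := by
  refine ENNReal.tsum_eq_zero.2 fun k => ?_
  split_ifs with hk
  · simp [levelTerm_eq_zero hγ hn0 hn hnγ hx hk]
  · rfl

lemma le_levelSum (hγ : 0 < γ) (hn0 : 0 < n) (hn : 1 ≤ Real.log n) (hx : threshold γ n < x) :
    ENNReal.ofReal (Real.log x - Real.log (threshold γ n)) ≤ levelSum γ n x := by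
  have hthr : 0 < threshold γ n := threshold_pos (by exact_mod_cast hn0) hn
  obtain ⟨N, hN, hnN⟩ := (((tendsto_log_threshold_atTop γ).comp
    tendsto_natCast_atTop_atTop).eventually_ge_atTop (Real.log x) |>.and
      (eventually_ge_atTop n)).exists
  obtain ⟨m, rfl⟩ := Nat.exists_eq_add_of_le hnN
  refine le_trans ?_ (ENNReal.sum_le_tsum (Finset.range (n + m)))
  rw [sum_ite_ofReal_levelTerm]
  refine ENNReal.ofReal_le_ofReal ?_
  have := min_sub_min_le_sum_levelTerm hγ (hthr.trans hx) hn0 hn m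
  simp only [Function.comp_apply] at hN
  rwa [min_eq_left (Real.log_le_log hthr hx.le), min_eq_right hN] at this

end HarmonicSum

section Expectation

variable {Ω : Type*} [MeasureSpace Ω] {X : Ω → ℝ} {γ : ℝ} {n : ℕ}

lemma logMoment_eq_lintegral_indicator (hX : Measurable X) (t : ℝ) :
    logMoment X t = ∫⁻ ω, {ω | t < X ω}.indicator
      (fun ω => ENNReal.ofReal (X ω * (Real.log (X ω) - Real.log t))) ω ∂ℙ :=
  (lintegral_indicator (measurableSet_lt measurable_const hX) _).symm

lemma logMoment_anti {s t : ℝ} (hX0 : ∀ ω, 0 ≤ X ω) (hs : 0 < s)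
    (hst : s ≤ t) : logMoment X t ≤ logMoment X s := by
  rw [logMoment, logMoment]
  refine (lintegral_mono fun ω => ENNReal.ofReal_le_ofReal ?_).trans
    (lintegral_mono_set fun ω (h : t < X ω) => hst.trans_lt h)
  exact mul_le_mul_of_nonneg_left (by linarith [Real.log_le_log hs hst]) (hX0 ω)

lemma tailSum_eq_lintegral (hX : Measurable X) (hn : 2 ≤ n) :
    tailSum X γ n = ∫⁻ ω, levelSum γ n (X ω) * ENNReal.ofReal (X ω) ∂ℙ := by
  have hset (k : ℕ) : MeasurableSet {ω | threshold γ k < X ω} :=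
    measurableSet_lt measurable_const hX
  have hterm (k : ℕ) (ω : Ω) :
      (if n ≤ k then ENNReal.ofReal (levelTerm γ (X ω) k) else 0) * ENNReal.ofReal (X ω) =
        if n ≤ k then (k : ℝ≥0∞)⁻¹ *
          {ω | threshold γ k < X ω}.indicator (fun ω => ENNReal.ofReal (X ω)) ω else 0 := by
    split_ifs with hk
    · have hk0 : (0 : ℝ) < k := by exact_mod_cast (by omega : 0 < k)
      by_cases h : threshold γ k < X ω
      · simp [levelTerm, h, ENNReal.ofReal_inv_of_pos hk0]
      · simp [levelTerm, h]
    · simp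
  simp_rw [levelSum, ← ENNReal.tsum_mul_right, hterm]
  rw [lintegral_tsum]
  · refine tsum_congr fun k => ?_
    by_cases hk : n ≤ k
    · simp only [hk, (by omega : 2 ≤ k), and_self, if_true]
      rw [lintegral_const_mul _ (hX.ennreal_ofReal.indicator (hset k)),
        lintegral_indicator (hset k)]
      rfl
    · simp [hk]
  · intro k
    by_cases hk : n ≤ k
    · simpa only [hk, if_true] using
        ((hX.ennreal_ofReal.indicator (hset k)).const_mul _).aemeasurable
    · simp only [hk, if_false, aemeasurable_const]

lemma logMoment_le_tailSum (hX : Measurable X) (hX0 : ∀ ω, 0 ≤ X ω) (hγ : 0 < γ) (hn2 : 2 ≤ n)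
    (hn : 1 ≤ Real.log n) : logMoment X (threshold γ n) ≤ tailSum X γ n := by
  rw [tailSum_eq_lintegral hX hn2, logMoment_eq_lintegral_indicator hX]
  refine lintegral_mono (Set.indicator_le fun ω hω => ?_)
  rw [mul_comm, ENNReal.ofReal_mul' (hX0 ω)]
  gcongr
  exact le_levelSum hγ (by omega) hn hω

lemma tailSum_le (hX : Measurable X) (hX0 : ∀ ω, 0 ≤ X ω) (hγ : 0 < γ) (hn2 : 2 ≤ n)
    (hn : 1 ≤ Real.log n) (hnγ : 2 * γ ≤ Real.log n) :
    tailSum X γ n ≤ ENNReal.ofReal (n : ℝ)⁻¹ * ∫⁻ ω, ENNReal.ofReal (X ω) ∂ℙ +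
      2 * logMoment X (threshold γ n) := by
  rw [tailSum_eq_lintegral hX hn2, logMoment_eq_lintegral_indicator hX,
    ← lintegral_const_mul _ hX.ennreal_ofReal, ← lintegral_const_mul' _ _ (by simp),
    ← lintegral_add_left (hX.ennreal_ofReal.const_mul _)]
  refine lintegral_mono fun ω => ?_
  by_cases h : threshold γ n < X ω
  · simp only [Set.indicator, Set.mem_ofPred_eq, h, if_true]
    refine (mul_le_mul_left (levelSum_le hγ (by omega) hn hnγ h) _).trans_eq ?_
    rw [mul_comm (X ω), ENNReal.ofReal_mul' (hX0 ω), add_mul, mul_assoc 2]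
  · simp [levelSum_eq_zero hγ (by omega) hn hnγ (not_lt.1 h)]

end Expectation

lemma ofReal_rpow_le_of_le_two_mul {γ a b : ℝ} (hγ : 0 < γ) (ha : 0 ≤ a) (hab : a ≤ 2 * b) :
    ENNReal.ofReal (a ^ γ) ≤ ENNReal.ofReal (2 ^ γ) * ENNReal.ofReal (b ^ γ) := by
  rw [← ENNReal.ofReal_mul (by positivity), ← Real.mul_rpow (by norm_num) (by linarith)]
  exact ENNReal.ofReal_le_ofReal (Real.rpow_le_rpow ha hab hγ.le)

lemma tendsto_log_natCast_atTop : Tendsto (fun n : ℕ => Real.log n) atTop atTop :=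
  Real.tendsto_log_atTop.comp tendsto_natCast_atTop_atTop

lemma tendsto_ofReal_log_rpow_mul_inv (γ : ℝ) :
    Tendsto (fun n : ℕ => ENNReal.ofReal (Real.log n ^ γ) * ENNReal.ofReal (n : ℝ)⁻¹)
      atTop (nhds 0) := by
  have h := (isLittleO_log_rpow_rpow_atTop γ one_pos).tendsto_div_nhds_zero.comp
    (tendsto_natCast_atTop_atTop (R := ℝ))
  have h' := ENNReal.tendsto_ofReal h
  rw [ENNReal.ofReal_zero] at h'
  refine h'.congr fun n => ?_
  rw [← ENNReal.ofReal_mul' (by positivity)]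
  simp [div_eq_mul_inv]

section Limits

variable {Ω : Type*} [MeasureSpace Ω] {X : Ω → ℝ} {γ : ℝ}

lemma tendsto_logMoment_of_tendsto_tailSum (hX : Measurable X) (hX0 : ∀ ω, 0 ≤ X ω)
    (hγ : 0 < γ)
    (h : Tendsto (fun n : ℕ => ENNReal.ofReal (Real.log n ^ γ) * tailSum X γ n)
      atTop (nhds 0)) :
    Tendsto (fun t : ℝ => ENNReal.ofReal (Real.log t ^ γ) * logMoment X t) atTop (nhds 0) := by
  have hlim := ENNReal.Tendsto.const_mul (a := ENNReal.ofReal (2 ^ γ))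
    (h.comp (tendsto_nat_floor_atTop (α := ℝ))) (Or.inr ENNReal.ofReal_ne_top)
  rw [mul_zero] at hlim
  refine tendsto_of_tendsto_of_tendsto_of_le_of_le' tendsto_const_nhds hlim
    (Eventually.of_forall fun _ => zero_le) ?_
  filter_upwards [(tendsto_nat_floor_atTop (α := ℝ)).eventually
      ((tendsto_log_natCast_atTop.eventually_ge_atTop 1).and (eventually_ge_atTop 2)),
    eventually_ge_atTop 1] with t ⟨hlog, htwo⟩ ht
  have hpos : (0 : ℝ) < ⌊t⌋₊ := by exact_mod_cast (by omega : 0 < ⌊t⌋₊)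
  have htwo' : (2 : ℝ) ≤ ⌊t⌋₊ := by exact_mod_cast htwo
  have hfloor : Real.log t ≤ 2 * Real.log ⌊t⌋₊ := by
    rw [← Nat.cast_two, ← Real.log_pow]
    refine Real.log_le_log (by linarith) ?_
    nlinarith [Nat.lt_floor_add_one t]
  calc ENNReal.ofReal (Real.log t ^ γ) * logMoment X t
      ≤ (ENNReal.ofReal (2 ^ γ) * ENNReal.ofReal (Real.log ⌊t⌋₊ ^ γ)) * tailSum X γ ⌊t⌋₊ := by
        refine mul_le_mul' (ofReal_rpow_le_of_le_two_mul hγ (Real.log_nonneg ht) hfloor) ?_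
        refine le_trans ?_ (logMoment_le_tailSum hX hX0 hγ htwo hlog)
        exact logMoment_anti hX0 (threshold_pos hpos hlog)
          ((threshold_le_self hγ hpos hlog).trans (Nat.floor_le (by linarith)))
    _ = _ := mul_assoc _ _ _

lemma tendsto_tailSum_of_tendsto_logMoment (hX : Measurable X) (hX0 : ∀ ω, 0 ≤ X ω)
    (hXint : Integrable X ℙ) (hγ : 0 < γ)
    (h : Tendsto (fun t : ℝ => ENNReal.ofReal (Real.log t ^ γ) * logMoment X t)
      atTop (nhds 0)) :
    Tendsto (fun n : ℕ => ENNReal.ofReal (Real.log n ^ γ) * tailSum X γ n)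
      atTop (nhds 0) := by
  have hmean : ∫⁻ ω, ENNReal.ofReal (X ω) ∂ℙ ≠ ∞ := hXint.lintegral_lt_top.ne
  have hlim := (ENNReal.Tendsto.mul_const (tendsto_ofReal_log_rpow_mul_inv γ)
    (Or.inr hmean)).add (ENNReal.Tendsto.const_mul (a := 2 * ENNReal.ofReal (2 ^ γ))
      (h.comp ((tendsto_threshold_atTop γ).comp tendsto_natCast_atTop_atTop))
      (Or.inr (ENNReal.mul_ne_top (by simp) ENNReal.ofReal_ne_top)))
  rw [zero_mul, mul_zero, add_zero] at hlim
  refine tendsto_of_tendsto_of_tendsto_of_le_of_le' tendsto_const_nhds hlim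
    (Eventually.of_forall fun _ => zero_le) ?_
  filter_upwards [tendsto_log_natCast_atTop.eventually_ge_atTop 1,
    tendsto_log_natCast_atTop.eventually_ge_atTop (2 * γ), eventually_ge_atTop 2,
    tendsto_natCast_atTop_atTop.eventually (eventually_log_le_two_mul_log_threshold γ)]
    with n hn hnγ hn2 hthr
  calc ENNReal.ofReal (Real.log n ^ γ) * tailSum X γ n
      ≤ ENNReal.ofReal (Real.log n ^ γ) *
          (ENNReal.ofReal (n : ℝ)⁻¹ * ∫⁻ ω, ENNReal.ofReal (X ω) ∂ℙ +
            2 * logMoment X (threshold γ n)) := by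
        gcongr
        exact tailSum_le hX hX0 hγ hn2 hn hnγ
    _ = ENNReal.ofReal (Real.log n ^ γ) * ENNReal.ofReal (n : ℝ)⁻¹ *
          ∫⁻ ω, ENNReal.ofReal (X ω) ∂ℙ +
        2 * (ENNReal.ofReal (Real.log n ^ γ) * logMoment X (threshold γ n)) := by ring
    _ ≤ ENNReal.ofReal (Real.log n ^ γ) * ENNReal.ofReal (n : ℝ)⁻¹ *
          ∫⁻ ω, ENNReal.ofReal (X ω) ∂ℙ +
        2 * ((ENNReal.ofReal (2 ^ γ) * ENNReal.ofReal (Real.log (threshold γ n) ^ γ)) *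
          logMoment X (threshold γ n)) := by
        gcongr
        exact ofReal_rpow_le_of_le_two_mul hγ (by linarith) hthr
    _ = _ := by simp only [Function.comp_apply, mul_assoc]

end Limits

end TruncatedMoment

/-- Let `X ≥ 0` be integrable and `γ > 0`. Then
`(log n)^γ · ∑_{k ≥ n, k ≥ 2} k⁻¹ E[X 1_{X > k (log k)^{-γ}}] → 0` (n → ∞) if and only if
`(log t)^γ · E[X (log X - log t) 1_{X > t}] → 0` (t → ∞). -/
theorem tendsto_tail_sum_iff_tendsto_truncated_moment
    {Ω : Type*} [MeasureSpace Ω] [IsProbabilityMeasure (ℙ : Measure Ω)]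
    (X : Ω → ℝ) (hXmeas : Measurable X) (hXnn : ∀ ω, 0 ≤ X ω)
    (hXint : Integrable X ℙ)
    (γ : ℝ) (hγ : 0 < γ) :
    Tendsto (fun n : ℕ =>
        ENNReal.ofReal (Real.log n ^ γ) *
          ∑' k : ℕ, (if 2 ≤ k ∧ n ≤ k then
            ((k : ℝ≥0∞))⁻¹ *
              ∫⁻ ω in {ω | (k : ℝ) * Real.log (k : ℝ) ^ (-γ) < X ω},
                ENNReal.ofReal (X ω) ∂ℙ
          else 0)) atTop (nhds 0)
      ↔ Tendsto (fun t : ℝ =>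
          ENNReal.ofReal (Real.log t ^ γ) *
            ∫⁻ ω in {ω | t < X ω},
              ENNReal.ofReal (X ω * (Real.log (X ω) - Real.log t)) ∂ℙ)
        atTop (nhds 0) := by
  exact ⟨TruncatedMoment.tendsto_logMoment_of_tendsto_tailSum hXmeas hXnn hγ,
    TruncatedMoment.tendsto_tailSum_of_tendsto_logMoment hXmeas hXnn hXint hγ⟩
end
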